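/- arXiv:2509.25759 — 3 statements merged into one kernel-verified Lean document; each statement's English description precedes it below -/
import Mathlib

section
/- Let θ, ν, C be positive real numbers. Let W : ℝ → ℝ be differentiable and nonincreasing with W′(b) = 0 for every b ≥ C. Let I : ℝ → ℝ be differentiable with I(x) ≤ 0 for every x and I′(x) ≤ I(x)/x for every x > 0. Define F : ℝ → ℝ by F(a) := W(θ(1 − a)) + (θ/ν)·I(νa). Suppose a ∈ (0,1) satisfies F(a) ≤ F(x) for every x ∈ [0,1], and F(0) > F(a). Then θ(1 − a) < C. -/
open Set

/-- Abstract supercritical mass bound: if `W` is differentiable,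
nonincreasing with `W' = 0` on `[C,∞)`, `I` is differentiable, nonpositive with
`I'(x) ≤ I(x)/x` for `x > 0`, `F(a) = W(θ(1-a)) + (θ/ν)·I(νa)`, and `a ∈ (0,1)` minimizes
`F` over `[0,1]` with `F(0) > F(a)`, then `θ(1-a) < C`. -/
theorem supercritical_minimizer_mass (θ ν C : ℝ) (hθ : 0 < θ) (hν : 0 < ν) (hC : 0 < C)
    (W I : ℝ → ℝ) (hW : Differentiable ℝ W) (hWanti : Antitone W)
    (hW' : ∀ b : ℝ, C ≤ b → deriv W b = 0)
    (hI : Differentiable ℝ I) (hIneg : ∀ x : ℝ, I x ≤ 0)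
    (hI' : ∀ x : ℝ, 0 < x → deriv I x ≤ I x / x)
    (a : ℝ) (ha : a ∈ Set.Ioo (0 : ℝ) 1)
    (hmin : ∀ x ∈ Set.Icc (0 : ℝ) 1,
      W (θ * (1 - a)) + θ / ν * I (ν * a) ≤ W (θ * (1 - x)) + θ / ν * I (ν * x))
    (h0 : W (θ * (1 - a)) + θ / ν * I (ν * a) < W (θ * (1 - 0)) + θ / ν * I (ν * 0)) :
    θ * (1 - a) < C := by
  obtain ⟨ha0, ha1⟩ := ha
  by_contra! hCa
  have hνa : 0 < ν * a := mul_pos hν ha0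
  have hloc : IsLocalMin (fun x => W (θ * (1 - x)) + θ / ν * I (ν * x)) a := by
    filter_upwards [Icc_mem_nhds ha0 ha1] with x hx using hmin x hx
  have hlin : HasDerivAt (fun x : ℝ => θ * (1 - x)) (θ * -1) a :=
    ((hasDerivAt_id a).const_sub 1).const_mul θ
  have hscale : HasDerivAt (fun x : ℝ => ν * x) (ν * 1) a :=
    (hasDerivAt_id a).const_mul ν
  have hF : HasDerivAt (fun x => W (θ * (1 - x)) + θ / ν * I (ν * x))
      (deriv W (θ * (1 - a)) * (θ * -1) + θ / ν * (deriv I (ν * a) * (ν * 1))) a :=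
    ((hW _).hasDerivAt.comp a hlin).add
      (((hI _).hasDerivAt.comp a hscale).const_mul (θ / ν))
  have hcrit := hloc.hasDerivAt_eq_zero hF
  rw [hW' _ hCa] at hcrit
  have hderiv : deriv I (ν * a) = 0 := by
    field_simp at hcrit
    simpa [hθ.ne'] using hcrit
  have hdiv : 0 ≤ I (ν * a) / (ν * a) := hderiv ▸ hI' _ hνa
  have hI0 : I (ν * a) = 0 :=
    le_antisymm (hIneg _) (by simpa using (le_div_iff₀ hνa).1 hdiv)
  have hWle : W (θ * (1 - 0)) ≤ W (θ * (1 - a)) :=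
    hWanti (mul_le_mul_of_nonneg_left (by linarith) hθ.le)
  have hIle : θ / ν * I (ν * 0) ≤ 0 :=
    mul_nonpos_of_nonneg_of_nonpos (by positivity) (hIneg _)
  rw [hI0, mul_zero, add_zero] at h0
  exact h0.not_ge ((add_le_of_nonpos_right hIle).trans hWle)
end

section
/- Fix an integer d ≥ 4. There exists a constant C > 0 such that for every η ∈ (0,1], ∫_{[0,η]×[0,1]^{d−1}} (4∑_{i=1}^d sin²(πx_i))^{−1} dx ≤ C·η, where the integral is the Lebesgue integral over the box [0,η]×[0,1]^{d−1} ⊆ ℝ^d. -/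
open Finset MeasureTheory Set

/-- On `(0, 1)`, negative powers of `sin² (π t)` are controlled by the corresponding negative powers
of the distances to the endpoints. -/
lemma rpow_neg_sin_sq_le {q t : ℝ} (hq : 0 ≤ q) (ht : t ∈ Set.Ioo (0 : ℝ) 1) :
    (Real.sin (Real.pi * t) ^ 2) ^ (-q) ≤ t ^ (-(2 * q)) + (1 - t) ^ (-(2 * q)) := by
  have key : ∀ u : ℝ, 0 < u → u ≤ 1 / 2 →
      (Real.sin (Real.pi * u) ^ 2) ^ (-q) ≤ u ^ (-(2 * q)) := by
    intro u hu hu2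
    have hsin : 2 / Real.pi * (Real.pi * u) ≤ Real.sin (Real.pi * u) :=
      Real.mul_le_sin (by positivity) (by nlinarith [Real.pi_pos])
    have hcancel : 2 / Real.pi * (Real.pi * u) = 2 * u := by field_simp
    calc (Real.sin (Real.pi * u) ^ 2) ^ (-q) ≤ (u ^ 2) ^ (-q) :=
          Real.rpow_le_rpow_of_nonpos (by positivity)
            (pow_le_pow_left₀ hu.le (by linarith) 2) (by linarith)
      _ = u ^ (-(2 * q)) := by
          rw [← Real.rpow_natCast, ← Real.rpow_mul hu.le]
          congr 1
          push_cast
          ring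
  have ht1 : 0 < 1 - t := by linarith [ht.2]
  rcases le_total t (1 / 2) with h | h
  · exact (key t ht.1 h).trans (le_add_of_nonneg_right (by positivity))
  · have hsymm : Real.sin (Real.pi * t) = Real.sin (Real.pi * (1 - t)) := by
      rw [mul_sub, mul_one, Real.sin_pi_sub]
    rw [hsymm]
    exact (key (1 - t) ht1 (by linarith)).trans
      (le_add_of_nonneg_left (Real.rpow_nonneg ht.1.le _))

lemma integrableOn_rpow_add_one_sub_rpow {p : ℝ} (hp : -1 < p) :
    IntegrableOn (fun t : ℝ => t ^ p + (1 - t) ^ p) (Set.Icc 0 1) := by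
  have h : IntervalIntegrable (fun t : ℝ => t ^ p) volume 0 1 :=
    intervalIntegral.intervalIntegrable_rpow' hp
  have h' : IntervalIntegrable (fun t : ℝ => (1 - t) ^ p) volume 0 1 := by
    simpa using (h.comp_sub_left 1).symm
  exact (intervalIntegrable_iff_integrableOn_Icc_of_le zero_le_one).1 (h.add h')

/-- Up to the factor `4`, the inverse of a sum of nonnegative terms is at most the product of the
inverse `n`-th roots of its last `n` terms. -/
lemma inv_four_mul_sum_le_prod_rpow {n : ℕ} (hn : n ≠ 0) {s : Fin (n + 1) → ℝ}
    (h0 : 0 ≤ s 0) (hs : ∀ i : Fin n, 0 < s i.succ) :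
    (4 * ∑ i, s i)⁻¹ ≤ ∏ i : Fin n, s i.succ ^ (-(1 / n : ℝ)) := by
  have hle : ∀ i : Fin n, s i.succ ≤ ∑ i, s i := fun i =>
    Finset.single_le_sum (f := s) (fun j _ => Fin.cases h0 (fun k => (hs k).le) j)
      (Finset.mem_univ _)
  set M := ∑ i, s i
  have hM : 0 < M := (hs ⟨0, Nat.pos_of_ne_zero hn⟩).trans_le (hle _)
  calc (4 * M)⁻¹ ≤ M⁻¹ := inv_anti₀ hM (by linarith)
    _ = ∏ _i : Fin n, M ^ (-(1 / n : ℝ)) := by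
        have hn' : (n : ℝ) ≠ 0 := Nat.cast_ne_zero.2 hn
        rw [Finset.prod_const, Finset.card_univ, Fintype.card_fin, ← Real.rpow_natCast,
          ← Real.rpow_mul hM.le, neg_mul, one_div_mul_cancel hn', Real.rpow_neg_one]
    _ ≤ ∏ i : Fin n, s i.succ ^ (-(1 / n : ℝ)) :=
        Finset.prod_le_prod (fun _ _ => by positivity) fun i _ =>
          Real.rpow_le_rpow_of_nonpos (hs i) (hle i) (by simp)

/-- Corner estimate in dimension `d ≥ 4`: there is `C > 0` such that for
every `η ∈ (0,1]`,
`∫_{[0,η]×[0,1]^{d-1}} (4∑ᵢ sin²(πxᵢ))⁻¹ dx ≤ C·η`. -/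
theorem corner_estimate_high_dim (d : ℕ) (hd : 4 ≤ d) :
    ∃ C > (0 : ℝ), ∀ η ∈ Set.Ioc (0 : ℝ) 1,
      (∫ x in Set.univ.pi (fun i : Fin d =>
          if i = (⟨0, by omega⟩ : Fin d) then Set.Icc 0 η else Set.Icc 0 1),
        (4 * ∑ i, Real.sin (Real.pi * x i) ^ 2)⁻¹) ≤ C * η := by
  obtain ⟨n, rfl⟩ : ∃ n, d = n + 1 := ⟨d - 1, by omega⟩
  have hn : (3 : ℝ) ≤ n := by exact_mod_cast (show 3 ≤ n by omega)
  have hp : -1 < -(2 * (1 / n : ℝ)) := by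
    have : (1 / n : ℝ) ≤ 1 / 3 := one_div_le_one_div_of_le (by norm_num) hn
    linarith
  set g : ℝ → ℝ := fun t => t ^ (-(2 * (1 / n : ℝ))) + (1 - t) ^ (-(2 * (1 / n : ℝ)))
  have hgint : IntegrableOn g (Set.Icc 0 1) := integrableOn_rpow_add_one_sub_rpow hp
  have hA : 0 ≤ ∫ t in Set.Icc 0 1, g t := setIntegral_nonneg measurableSet_Icc fun t ht =>
    add_nonneg (Real.rpow_nonneg ht.1 _) (Real.rpow_nonneg (by linarith [ht.2]) _)
  refine ⟨(∫ t in Set.Icc 0 1, g t) ^ n + 1, by positivity, fun η hη => ?_⟩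
  set S : Fin (n + 1) → Set ℝ := fun i => if i = 0 then Set.Icc 0 η else Set.Icc 0 1
  have hS0 : S 0 = Set.Icc 0 η := if_pos rfl
  have hSs : ∀ i : Fin n, S i.succ = Set.Icc 0 1 := fun i => if_neg (Fin.succ_ne_zero i)
  change ∫ x in univ.pi S, (4 * ∑ i, Real.sin (Real.pi * x i) ^ 2)⁻¹ ≤ _
  set μ : Fin (n + 1) → Measure ℝ := fun i => volume.restrict (S i)
  have hμ0 : μ 0 = volume.restrict (Set.Icc 0 η) := by rw [← hS0]
  have hμs : ∀ i : Fin n, μ i.succ = volume.restrict (Set.Icc 0 1) := fun i => by rw [← hSs i]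
  set F : Fin (n + 1) → ℝ → ℝ := Fin.cons (fun _ => 1) fun _ => g with hF
  have hvol : (volume : Measure (Fin (n + 1) → ℝ)).restrict (univ.pi S) = Measure.pi μ :=
    Measure.restrict_pi_pi _ _
  rw [hvol]
  have hFint : Integrable (fun x : Fin (n + 1) → ℝ => ∏ i, F i (x i)) (Measure.pi μ) := by
    refine Integrable.fintype_prod fun i => ?_
    refine Fin.cases ?_ (fun j => ?_) i
    · rw [hμ0]
      exact integrableOn_const (by simp)
    · rw [hμs]
      exact hgint
  have hmem : ∀ᵐ x ∂Measure.pi μ, ∀ i : Fin n, x i.succ ∈ Set.Ioo (0 : ℝ) 1 := by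
    refine ae_all_iff.2 fun i => ?_
    refine Measure.tendsto_eval_ae_ae.eventually (p := fun t => t ∈ Set.Ioo (0 : ℝ) 1) ?_
    rw [hμs, ← restrict_Ioo_eq_restrict_Icc]
    exact ae_restrict_mem measurableSet_Ioo
  calc ∫ x, (4 * ∑ i, Real.sin (Real.pi * x i) ^ 2)⁻¹ ∂Measure.pi μ
      ≤ ∫ x, ∏ i, F i (x i) ∂Measure.pi μ := by
        refine integral_mono_of_nonneg (ae_of_all _ fun x => by positivity) hFint ?_
        filter_upwards [hmem] with x hx
        have hsin : ∀ i : Fin n, 0 < Real.sin (Real.pi * x i.succ) ^ 2 := fun i =>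
          pow_pos (Real.sin_pos_of_pos_of_lt_pi (mul_pos Real.pi_pos (hx i).1)
            (mul_lt_of_lt_one_right Real.pi_pos (hx i).2)) 2
        rw [Fin.prod_univ_succ]
        simp only [hF, Fin.cons_zero, Fin.cons_succ, one_mul]
        exact (inv_four_mul_sum_le_prod_rpow (s := fun i => Real.sin (Real.pi * x i) ^ 2)
          (by omega) (sq_nonneg _) hsin).trans <|
          Finset.prod_le_prod (fun _ _ => by positivity) fun i _ =>
            rpow_neg_sin_sq_le (by positivity) (hx i)
    _ = ∏ i, ∫ t, F i t ∂μ i := integral_fintype_prod_eq_prod _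
    _ = η * (∫ t in Set.Icc 0 1, g t) ^ n := by
        rw [Fin.prod_univ_succ]
        simp only [hF, Fin.cons_zero, Fin.cons_succ, hμ0, hμs]
        simp [hη.1.le]
    _ ≤ ((∫ t in Set.Icc 0 1, g t) ^ n + 1) * η := by linarith [hη.1]
end

section
/- There exists a constant C > 0 such that for every η ∈ (0, 1/2], ∫_{[0,η]×[0,1]²} (4(sin²(πx₁) + sin²(πx₂) + sin²(πx₃)))^{−1} dx ≤ C·η·(1 + log(1/η)), where the integral is the Lebesgue integral over the box [0,η]×[0,1]² ⊆ ℝ³. -/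
open Finset MeasureTheory Set

theorem two_mul_le_sin_pi_mul {x : ℝ} (h0 : 0 ≤ x) (h1 : x ≤ 1 / 2) :
    2 * x ≤ Real.sin (Real.pi * x) := by
  have h := Real.mul_le_sin (x := Real.pi * x) (by positivity) (by nlinarith [Real.pi_pos])
  have h' : 2 / Real.pi * (Real.pi * x) = 2 * x := by
    field_simp
  rwa [h'] at h

/-- On `[0,1]`, `sin (π x)` is at least twice the distance from `x` to the nearest endpoint. -/
theorem two_mul_le_sin_pi_mul_or {x : ℝ} (hx : x ∈ Set.Icc (0 : ℝ) 1) :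
    2 * x ≤ Real.sin (Real.pi * x) ∨ 2 * (1 - x) ≤ Real.sin (Real.pi * x) := by
  rcases le_total x (1 / 2) with h | h
  · exact Or.inl (two_mul_le_sin_pi_mul hx.1 h)
  · right
    have h' := two_mul_le_sin_pi_mul (x := 1 - x) (by linarith [hx.2]) (by linarith)
    rwa [show Real.pi * (1 - x) = Real.pi - Real.pi * x by ring, Real.sin_pi_sub] at h'

theorem inv_sq_add_sq_eq {A : ℝ} (hA : 0 < A) (c : ℝ) :
    (A ^ 2 + c ^ 2)⁻¹ = (A ^ 2)⁻¹ * (1 + (A⁻¹ * c) ^ 2)⁻¹ := by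
  rw [← mul_inv]
  congr 1
  field_simp

theorem integrable_inv_sq_add_sq {A : ℝ} (hA : 0 < A) :
    Integrable (fun c : ℝ => (A ^ 2 + c ^ 2)⁻¹) := by
  simp_rw [inv_sq_add_sq_eq hA]
  exact (integrable_inv_one_add_sq.comp_mul_left' (inv_ne_zero hA.ne')).const_mul _

theorem integral_univ_inv_sq_add_sq_of_pos {A : ℝ} (hA : 0 < A) :
    ∫ c : ℝ, (A ^ 2 + c ^ 2)⁻¹ = Real.pi / A := by
  simp_rw [inv_sq_add_sq_eq hA]
  rw [integral_const_mul, Measure.integral_comp_mul_left (fun y : ℝ => (1 + y ^ 2)⁻¹),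
    integral_univ_inv_one_add_sq, inv_inv, abs_of_pos hA, smul_eq_mul]
  field_simp

theorem lintegral_inv_sq_add_sin_sq_le {A : ℝ} (hA : 0 < A) :
    ∫⁻ c in Set.Icc (0 : ℝ) 1, ENNReal.ofReal (A ^ 2 + Real.sin (Real.pi * c) ^ 2)⁻¹
      ≤ ENNReal.ofReal (2 * Real.pi / A) := by
  set g : ℝ → ENNReal := fun c => ENNReal.ofReal (A ^ 2 + c ^ 2)⁻¹ with hg
  have hgm : Measurable g := by fun_prop
  have hgi : ∫⁻ c, g c = ENNReal.ofReal (Real.pi / A) := by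
    rw [← integral_univ_inv_sq_add_sq_of_pos hA, ofReal_integral_eq_lintegral_ofReal
      (integrable_inv_sq_add_sq hA) (Filter.Eventually.of_forall fun c => by positivity)]
  have hpt : ∀ c ∈ Set.Icc (0 : ℝ) 1,
      ENNReal.ofReal (A ^ 2 + Real.sin (Real.pi * c) ^ 2)⁻¹ ≤ g c + g (1 - c) := by
    intro c hc
    have h0 := hc.1
    have h1 := hc.2
    rcases two_mul_le_sin_pi_mul_or hc with h | h
    · refine le_add_right (ENNReal.ofReal_le_ofReal (inv_anti₀ (by positivity) ?_))
      gcongr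
      linarith
    · refine le_add_left (ENNReal.ofReal_le_ofReal (inv_anti₀ (by positivity) ?_))
      have : 0 ≤ 1 - c := by linarith
      gcongr
      linarith
  calc _ ≤ ∫⁻ c in Set.Icc (0 : ℝ) 1, (g c + g (1 - c)) :=
        setLIntegral_mono' measurableSet_Icc hpt
    _ ≤ ∫⁻ c, (g c + g (1 - c)) := setLIntegral_le_lintegral _ _
    _ = ENNReal.ofReal (2 * Real.pi / A) := by
        rw [lintegral_add_left hgm, lintegral_sub_left_eq_self g, hgi,
          ← ENNReal.ofReal_add (by positivity) (by positivity)]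
        congr 1
        ring

theorem inv_sqrt_sin_sq_add_sin_sq_le {a b : ℝ} (ha : 0 < a) (ha' : a ≤ 1 / 2)
    (hb : b ∈ Set.Icc (0 : ℝ) 1) :
    (√(Real.sin (Real.pi * a) ^ 2 + Real.sin (Real.pi * b) ^ 2))⁻¹
      ≤ (a + b)⁻¹ + (a + (1 - b))⁻¹ := by
  have hsa := two_mul_le_sin_pi_mul ha.le ha'
  have h0 := hb.1
  have h1 : 0 ≤ 1 - b := sub_nonneg.2 hb.2
  have key : ∀ d : ℝ, 0 ≤ d → 2 * d ≤ Real.sin (Real.pi * b) →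
      (√(Real.sin (Real.pi * a) ^ 2 + Real.sin (Real.pi * b) ^ 2))⁻¹ ≤ (a + d)⁻¹ := by
    intro d hd h
    refine inv_anti₀ (by positivity) (Real.le_sqrt_of_sq_le ?_)
    nlinarith [sq_nonneg (a - d)]
  rcases two_mul_le_sin_pi_mul_or hb with h | h
  · exact (key _ h0 h).trans (le_add_of_nonneg_right (by positivity))
  · exact (key _ h1 h).trans (le_add_of_nonneg_left (by positivity))

theorem lintegral_inv_add_le {a : ℝ} (ha : 0 < a) (ha' : a ≤ 1) :
    ∫⁻ b in Set.Icc (0 : ℝ) 1, ENNReal.ofReal (Real.pi / 2 * ((a + b)⁻¹ + (a + (1 - b))⁻¹))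
      ≤ ENNReal.ofReal (Real.pi * (Real.log 2 - Real.log a)) := by
  have hc1 : ContinuousOn (fun b : ℝ => (a + b)⁻¹) (Set.Icc 0 1) :=
    ContinuousOn.inv₀ (by fun_prop) fun b hb => by linarith [hb.1]
  have hc2 : ContinuousOn (fun b : ℝ => (a + (1 - b))⁻¹) (Set.Icc 0 1) :=
    ContinuousOn.inv₀ (by fun_prop) fun b hb => by linarith [hb.2]
  have hi : IntegrableOn (fun b : ℝ => Real.pi / 2 * ((a + b)⁻¹ + (a + (1 - b))⁻¹))
      (Set.Icc 0 1) :=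
    (continuousOn_const.mul (hc1.add hc2)).integrableOn_Icc
  rw [← ofReal_integral_eq_lintegral_ofReal hi]
  · refine ENNReal.ofReal_le_ofReal ?_
    have e1 : ∫ b in (0 : ℝ)..1, (a + b)⁻¹ = Real.log ((a + 1) / a) := by
      rw [intervalIntegral.integral_comp_add_left (fun x => x⁻¹),
        integral_inv_of_pos (by linarith) (by linarith), add_zero]
    have e2 : ∫ b in (0 : ℝ)..1, (a + (1 - b))⁻¹ = Real.log ((a + 1) / a) := by
      rw [intervalIntegral.integral_comp_sub_left (fun x => (a + x)⁻¹), sub_self, sub_zero, e1]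
    rw [integral_Icc_eq_integral_Ioc, ← intervalIntegral.integral_of_le zero_le_one,
      intervalIntegral.integral_const_mul, intervalIntegral.integral_add, e1, e2,
      Real.log_div (by linarith) ha.ne']
    · have : Real.log (a + 1) ≤ Real.log 2 := Real.log_le_log (by linarith) (by linarith)
      nlinarith [Real.pi_pos]
    · exact ContinuousOn.intervalIntegrable (by rwa [Set.uIcc_of_le zero_le_one])
    · exact ContinuousOn.intervalIntegrable (by rwa [Set.uIcc_of_le zero_le_one])
  · filter_upwards [ae_restrict_mem measurableSet_Icc] with b hb
    have h0 := hb.1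
    have h1 : 0 ≤ 1 - b := sub_nonneg.2 hb.2
    have := Real.pi_pos
    show 0 ≤ Real.pi / 2 * ((a + b)⁻¹ + (a + (1 - b))⁻¹)
    positivity

theorem lintegral_slice_le {a : ℝ} (ha : 0 < a) (ha' : a ≤ 1 / 2) :
    ∫⁻ b in Set.Icc (0 : ℝ) 1, ∫⁻ c in Set.Icc (0 : ℝ) 1,
      ENNReal.ofReal (4 * (Real.sin (Real.pi * a) ^ 2 + Real.sin (Real.pi * b) ^ 2
        + Real.sin (Real.pi * c) ^ 2))⁻¹
      ≤ ENNReal.ofReal (Real.pi * (Real.log 2 - Real.log a)) := by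
  refine (setLIntegral_mono' measurableSet_Icc fun b hb => ?_).trans
    (lintegral_inv_add_le ha (by linarith))
  have hsa : 0 < Real.sin (Real.pi * a) := by linarith [two_mul_le_sin_pi_mul ha.le ha']
  set A := √(Real.sin (Real.pi * a) ^ 2 + Real.sin (Real.pi * b) ^ 2) with hA
  have hApos : 0 < A := Real.sqrt_pos.2 (by positivity)
  have hAsq : A ^ 2 = Real.sin (Real.pi * a) ^ 2 + Real.sin (Real.pi * b) ^ 2 :=
    Real.sq_sqrt (by positivity)
  calc ∫⁻ c in Set.Icc (0 : ℝ) 1,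
      ENNReal.ofReal (4 * (Real.sin (Real.pi * a) ^ 2 + Real.sin (Real.pi * b) ^ 2
        + Real.sin (Real.pi * c) ^ 2))⁻¹
      = ENNReal.ofReal 4⁻¹ * ∫⁻ c in Set.Icc (0 : ℝ) 1,
          ENNReal.ofReal (A ^ 2 + Real.sin (Real.pi * c) ^ 2)⁻¹ := by
        rw [← lintegral_const_mul _ (by fun_prop)]
        simp_rw [hAsq, mul_inv, ENNReal.ofReal_mul (show (0 : ℝ) ≤ 4⁻¹ by norm_num)]
    _ ≤ ENNReal.ofReal 4⁻¹ * ENNReal.ofReal (2 * Real.pi / A) := by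
        gcongr
        exact lintegral_inv_sq_add_sin_sq_le hApos
    _ = ENNReal.ofReal (Real.pi / 2 * A⁻¹) := by
        rw [← ENNReal.ofReal_mul (by norm_num)]
        congr 1
        ring
    _ ≤ _ := by
        refine ENNReal.ofReal_le_ofReal ?_
        have := Real.pi_pos
        gcongr
        exact inv_sqrt_sin_sq_add_sin_sq_le ha ha' hb

theorem lintegral_log_two_sub_log {η : ℝ} (h0 : 0 < η) (h1 : η ≤ 2) :
    ∫⁻ a in Set.Ioc (0 : ℝ) η, ENNReal.ofReal (Real.pi * (Real.log 2 - Real.log a))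
      = ENNReal.ofReal (Real.pi * η * (1 + Real.log 2 - Real.log η)) := by
  have hi : IntervalIntegrable (fun a : ℝ => Real.pi * (Real.log 2 - Real.log a)) volume 0 η :=
    (intervalIntegrable_const.sub intervalIntegral.intervalIntegrable_log').const_mul _
  rw [← ofReal_integral_eq_lintegral_ofReal hi.1]
  · rw [← intervalIntegral.integral_of_le h0.le, intervalIntegral.integral_const_mul,
      intervalIntegral.integral_sub intervalIntegrable_const
        intervalIntegral.intervalIntegrable_log', integral_log, intervalIntegral.integral_const]
    congr 1
    simp only [smul_eq_mul]
    ring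
  · filter_upwards [ae_restrict_mem measurableSet_Ioc] with a ha
    have := Real.log_le_log ha.1 (ha.2.trans h1)
    exact mul_nonneg Real.pi_pos.le (by linarith)

/-- Tonelli's theorem for a product of three measures on `ℝ` indexed by `Fin 3`. -/
theorem lintegral_pi_fin_three (μ : Fin 3 → Measure ℝ) [∀ i, SigmaFinite (μ i)]
    {f : (Fin 3 → ℝ) → ENNReal} (hf : Measurable f) :
    ∫⁻ x, f x ∂Measure.pi μ = ∫⁻ a, ∫⁻ b, ∫⁻ c, f ![a, b, c] ∂μ 2 ∂μ 1 ∂μ 0 := by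
  rw [← (measurePreserving_piFinSuccAbove μ 0).symm.lintegral_comp hf,
    lintegral_prod _ (by fun_prop)]
  refine lintegral_congr fun a => ?_
  rw [← (measurePreserving_piFinTwo fun j => μ (Fin.succAbove 0 j)).symm.lintegral_comp
    (by fun_prop), lintegral_prod _ (by fun_prop)]
  refine lintegral_congr fun b => lintegral_congr fun c => congrArg f ?_
  ext i
  fin_cases i <;> rfl

/-- Corner estimate in dimension `3`: there is `C > 0` such that for
every `η ∈ (0,1/2]`,
`∫_{[0,η]×[0,1]²} (4(sin²(πx₁)+sin²(πx₂)+sin²(πx₃)))⁻¹ dx ≤ C·η·(1 + log(1/η))`. -/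
theorem corner_estimate_dim_three :
    ∃ C > (0 : ℝ), ∀ η ∈ Set.Ioc (0 : ℝ) (1 / 2),
      (∫ x in Set.univ.pi (fun i : Fin 3 =>
          if i = (0 : Fin 3) then Set.Icc 0 η else Set.Icc 0 1),
        (4 * ∑ i, Real.sin (Real.pi * x i) ^ 2)⁻¹) ≤ C * η * (1 + Real.log (1 / η)) := by
  refine ⟨2 * Real.pi, by positivity, fun η hη => ?_⟩
  have hη0 := hη.1
  have hlog : Real.log η ≤ 0 := Real.log_nonpos hη0.le (by linarith [hη.2])
  have hmeas : Measurable fun x : Fin 3 → ℝ => (4 * ∑ i, Real.sin (Real.pi * x i) ^ 2)⁻¹ := by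
    fun_prop
  rw [integral_eq_lintegral_of_nonneg_ae (Filter.Eventually.of_forall fun x => by positivity)
    hmeas.aestronglyMeasurable]
  rw [one_div, Real.log_inv]
  refine ENNReal.toReal_le_of_le_ofReal
    (mul_nonneg (by positivity) (by linarith)) ?_
  rw [volume_pi, Measure.restrict_pi_pi, lintegral_pi_fin_three _ hmeas.ennreal_ofReal]
  simp only [Fin.sum_univ_three, Matrix.cons_val, if_true, Fin.reduceEq, if_false]
  calc _ = ∫⁻ a in Set.Ioc (0 : ℝ) η, ∫⁻ b in Set.Icc (0 : ℝ) 1, ∫⁻ c in Set.Icc (0 : ℝ) 1,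
      ENNReal.ofReal (4 * (Real.sin (Real.pi * a) ^ 2 + Real.sin (Real.pi * b) ^ 2
        + Real.sin (Real.pi * c) ^ 2))⁻¹ := setLIntegral_congr Ioc_ae_eq_Icc.symm
    _ ≤ ∫⁻ a in Set.Ioc (0 : ℝ) η, ENNReal.ofReal (Real.pi * (Real.log 2 - Real.log a)) :=
      setLIntegral_mono' measurableSet_Ioc fun a ha =>
        lintegral_slice_le ha.1 (ha.2.trans hη.2)
    _ = ENNReal.ofReal (Real.pi * η * (1 + Real.log 2 - Real.log η)) :=
      lintegral_log_two_sub_log hη0 (by linarith [hη.2])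
    _ ≤ _ := by
      refine ENNReal.ofReal_le_ofReal ?_
      have hlog2 : Real.log 2 ≤ 1 := by linarith [Real.log_two_lt_d9]
      have : 0 ≤ Real.pi * η := by positivity
      nlinarith
end
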